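/- For every finite simple graph G, the ℚ-rank-width of G is at most the maximum of the branch-width of G and 1. -/

import Mathlib

open scoped Classical

noncomputable def cutRank (F : Type) [Field F] {V : Type} [Fintype V]
    (G : SimpleGraph V) (A : Set V) : ℕ :=
  (Matrix.of (fun (u : A) (v : ↥Aᶜ) => if G.Adj u.1 v.1 then (1 : F) else 0)).rank

structure BranchDecomp (α : Type) [Fintype α] where
  τ : Type
  [fin : Fintype τ]
  T : SimpleGraph τ
  isTree : T.IsTree
  deg : ∀ v : τ, T.degree v = 1 ∨ T.degree v = 3
  δ : {v : τ // T.degree v = 1} ≃ α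

attribute [instance] BranchDecomp.fin

def BranchDecomp.side {α : Type} [Fintype α] (B : BranchDecomp α) (u v : B.τ) : Set α :=
  { x : α | (B.T.deleteEdges {s(u, v)}).Reachable u ((B.δ.symm x) : B.τ) }

noncomputable def BranchDecomp.width {α : Type} [Fintype α] (B : BranchDecomp α)
    (f : Set α → ℕ) : ℕ :=
  sSup { n | ∃ u v : B.τ, B.T.Adj u v ∧ f (B.side u v) = n }

noncomputable def fWidth (α : Type) [Fintype α] (f : Set α → ℕ) : ℕ :=
  if Fintype.card α ≤ 1 then f ∅
  else sInf { n | ∃ B : BranchDecomp α, B.width f = n }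

noncomputable def qRankWidth {V : Type} [Fintype V] (G : SimpleGraph V) : ℕ :=
  fWidth V (cutRank ℚ G)

/-- `incVerts X` is the set `T_X` of vertices incident with at least one edge of `X`. -/
def incVerts {V : Type} (X : Set (Sym2 V)) : Set V := { v | ∃ e ∈ X, v ∈ e }

/-- `eta G X = |T_X ∩ T_{E(G) \ X}|`. -/
noncomputable def eta {V : Type} [Fintype V] (G : SimpleGraph V) (X : Set (Sym2 V)) : ℕ :=
  (incVerts X ∩ incVerts (G.edgeSet \ X)).ncard

/-- `η_G` as a set function on the ground set `E(G)`, viewed as a subtype. -/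
noncomputable def etaE {V : Type} [Fintype V] (G : SimpleGraph V)
    (X : Set ↥G.edgeSet) : ℕ :=
  eta G (Subtype.val '' X)

/-- The branch-width of a graph: the `η_G`-width of its edge set. -/
noncomputable def graphBranchWidth {V : Type} [Fintype V] (G : SimpleGraph V) : ℕ :=
  fWidth ↥G.edgeSet (etaE G)

/-- `C` meets every edge of `G` with exactly one end in `A`. -/
def CoversCut {V : Type} (G : SimpleGraph V) (A C : Set V) : Prop :=
  ∀ a ∈ A, ∀ b ∉ A, G.Adj a b → a ∈ C ∨ b ∈ C

theorem CoversCut.compl {V : Type} {G : SimpleGraph V} {A C : Set V} (h : CoversCut G A C) :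
    CoversCut G Aᶜ C := fun a ha b hb hab =>
  (h b (not_not.mp hb) a ha hab.symm).symm

theorem cutRank_le_of_coversCut (F : Type) [Field F] {V : Type} [Fintype V]
    {G : SimpleGraph V} {A C : Set V} (h : CoversCut G A C) : cutRank F G A ≤ C.ncard := by
  let P : Matrix A C F := Matrix.of fun a c =>
    if c.1 ∈ A then (if a.1 = c.1 then 1 else 0)
    else if a.1 ∈ C then 0 else if G.Adj a.1 c.1 then 1 else 0
  let Q : Matrix C (↥Aᶜ) F := Matrix.of fun c b =>
    if c.1 ∈ A then (if G.Adj c.1 b.1 then 1 else 0) else if c.1 = b.1 then 1 else 0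
  have key : Matrix.of (fun (u : A) (v : ↥Aᶜ) => if G.Adj u.1 v.1 then (1 : F) else 0)
      = P * Q := by
    ext a b
    rw [Matrix.mul_apply]
    simp only [Matrix.of_apply, P, Q]
    have hb : b.1 ∉ A := b.2
    by_cases ha : a.1 ∈ C
    · rw [Finset.sum_eq_single ⟨a.1, ha⟩]
      · simp
      · intro c _ hc
        have : a.1 ≠ c.1 := fun h => hc (Subtype.ext h.symm)
        by_cases hcA : c.1 ∈ A <;> simp [hcA, this, ha]
      · simp
    · by_cases hbC : b.1 ∈ C
      · rw [Finset.sum_eq_single ⟨b.1, hbC⟩]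
        · simp [hb, ha]
        · intro c _ hc
          have h1 : c.1 ≠ b.1 := fun h => hc (Subtype.ext h)
          have h2 : a.1 ≠ c.1 := fun h => ha (h ▸ c.2)
          by_cases hcA : c.1 ∈ A <;> simp [hcA, h1, h2]
        · simp
      · have hab : ¬ G.Adj a.1 b.1 := fun hab => (h a a.2 b hb hab).elim ha hbC
        rw [Finset.sum_eq_zero]
        · simp [hab]
        · intro c _
          have h1 : c.1 ≠ b.1 := fun h => hbC (h ▸ c.2)
          have h2 : a.1 ≠ c.1 := fun h => ha (h ▸ c.2)
          by_cases hcA : c.1 ∈ A <;> simp [hcA, h1, h2]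
  rw [cutRank, key]
  refine (Matrix.rank_mul_le_left P Q).trans ((Matrix.rank_le_card_width P).trans_eq ?_)
  rw [← Nat.card_eq_fintype_card, Nat.card_coe_set_eq]

/-- `ClusterTree p S` says that `S` can be broken up into singletons by successive bipartitions
in which every occurring part satisfies `p`. -/
inductive ClusterTree {α : Type} (p : Set α → Prop) : Set α → Prop
  | single (x : α) : p {x} → ClusterTree p {x}
  | union (A B : Set α) : Disjoint A B → ClusterTree p A → ClusterTree p B → p (A ∪ B) →
      ClusterTree p (A ∪ B)

namespace ClusterTree

variable {α β : Type} {p : Set α → Prop}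

theorem self {S : Set α} (h : ClusterTree p S) : p S := by
  cases h <;> assumption

theorem mono {q : Set α → Prop} (hpq : ∀ A, p A → q A) {S : Set α} (h : ClusterTree p S) :
    ClusterTree q S := by
  induction h with
  | single x hx => exact .single x (hpq _ hx)
  | union A B hd _ _ hp ihA ihB => exact .union A B hd ihA ihB (hpq _ hp)

theorem of_forall_subset {S : Set α} (hfin : S.Finite) (hne : S.Nonempty)
    (h : ∀ A ⊆ S, p A) : ClusterTree p S := by
  induction S, hfin using Set.Finite.induction_on with
  | empty => exact absurd rfl hne.ne_empty
  | @insert a s ha _ ih =>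
    rcases s.eq_empty_or_nonempty with rfl | hs
    · rw [insert_empty_eq] at h ⊢
      exact .single a (h _ subset_rfl)
    · exact .union {a} s (by simpa using ha) (.single a (h _ (by simp)))
        (ih hs fun A hA => h A (hA.trans (Set.subset_insert a s))) (h _ subset_rfl)

theorem preimage {q : Set β → Prop} (φ : β → α) [Finite β]
    (hfib : ∀ e, p {e} → ∀ A ⊆ φ ⁻¹' {e}, q A) (hpq : ∀ A, p A → q (φ ⁻¹' A)) {S : Set α}
    (h : ClusterTree p S) (hne : (φ ⁻¹' S).Nonempty) : ClusterTree q (φ ⁻¹' S) := by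
  induction h with
  | single x hx => exact of_forall_subset (Set.toFinite _) hne (hfib x hx)
  | union A B hd _ _ hp ihA ihB =>
    rcases (φ ⁻¹' A).eq_empty_or_nonempty with hA | hA
    · rw [Set.preimage_union, hA, Set.empty_union] at hne ⊢
      exact ihB hne
    · rcases (φ ⁻¹' B).eq_empty_or_nonempty with hB | hB
      · rw [Set.preimage_union, hB, Set.union_empty]
        exact ihA hA
      · exact .union _ _ (hd.preimage φ) (ihA hA) (ihB hB) (hpq _ hp)

end ClusterTree

namespace SimpleGraph

theorem Reachable.mem_of_closed {V : Type*} {G : SimpleGraph V} {C : Set V}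
    (hC : ∀ a b, a ∈ C → G.Adj a b → b ∈ C) {u w : V} (h : G.Reachable u w) (hu : u ∈ C) :
    w ∈ C := by
  rw [reachable_iff_reflTransGen] at h
  induction h with
  | refl => exact hu
  | tail _ hab ih => exact hC _ _ ih hab

/-- The vertices in the component of `u` after deleting the edge `uv`. -/
def branch {V : Type*} (G : SimpleGraph V) (u v : V) : Set V :=
  {w | (G.deleteEdges {s(u, v)}).Reachable u w}

variable {V : Type*} {G : SimpleGraph V} {u v x y w : V}

theorem mem_branch_self (u v : V) : u ∈ G.branch u v := .rfl

theorem mem_branch_of_adj {a b : V} (ha : a ∈ G.branch u v) (hab : G.Adj a b)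
    (hne : s(a, b) ≠ s(u, v)) : b ∈ G.branch u v :=
  Reachable.trans ha (Adj.reachable (by simpa [deleteEdges_adj] using ⟨hab, by simpa using hne⟩))

theorem branch_subset_of_closed {C : Set V} (hu : u ∈ C)
    (hC : ∀ a b, a ∈ C → G.Adj a b → s(a, b) ≠ s(u, v) → b ∈ C) : G.branch u v ⊆ C := by
  intro w hw
  refine Reachable.mem_of_closed (fun a b ha hab => ?_) hw hu
  rw [deleteEdges_adj] at hab
  exact hC a b ha hab.1 (by simpa using hab.2)

theorem IsAcyclic.notMem_branch (hG : G.IsAcyclic) (h : G.Adj u v) : v ∉ G.branch u v :=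
  isBridge_iff.mp (isAcyclic_iff_forall_adj_isBridge.mp hG h)

theorem Connected.branch_union_branch (hG : G.Connected) (u v : V) :
    G.branch u v ∪ G.branch v u = Set.univ := by
  refine Set.eq_univ_of_forall fun w => ?_
  refine Reachable.mem_of_closed (fun a b ha hab => ?_) (hG u w) (Or.inl (mem_branch_self u v))
  by_cases hne : s(a, b) = s(u, v)
  · rcases Sym2.eq_iff.mp hne with ⟨-, rfl⟩ | ⟨-, rfl⟩
    · exact Or.inr (mem_branch_self _ _)
    · exact Or.inl (mem_branch_self _ _)
  · exact ha.imp (mem_branch_of_adj · hab hne)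
      (mem_branch_of_adj · hab (by rwa [Sym2.eq_swap (a := v)]))

theorem IsAcyclic.disjoint_branch (hG : G.IsAcyclic) (h : G.Adj u v) :
    Disjoint (G.branch u v) (G.branch v u) := by
  refine Set.disjoint_left.mpr fun w hw hw' => hG.notMem_branch h ?_
  rw [branch, Set.mem_ofPred_eq, Sym2.eq_swap] at hw'
  exact Reachable.trans hw hw'.symm

theorem IsAcyclic.branch_subset_branch (hG : G.IsAcyclic) (hxu : G.Adj x u) (hne : x ≠ v) :
    G.branch x u ⊆ G.branch u v := by
  suffices h : G.branch x u ⊆ G.branch x u ∩ G.branch u v from h.trans Set.inter_subset_right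
  refine branch_subset_of_closed ⟨mem_branch_self _ _, ?_⟩ fun a b ⟨ha, ha'⟩ hab hs => ?_
  · exact mem_branch_of_adj (mem_branch_self _ _) hxu.symm (by simp [hne, hxu.ne])
  · have hb := mem_branch_of_adj ha hab hs
    refine ⟨hb, mem_branch_of_adj ha' hab fun h => ?_⟩
    rcases Sym2.eq_iff.mp h with ⟨rfl, -⟩ | ⟨-, rfl⟩
    · exact hG.notMem_branch hxu ha
    · exact hG.notMem_branch hxu hb

theorem branch_subset_iUnion (u v : V) :
    G.branch u v ⊆ {u} ∪ {w | ∃ x, G.Adj x u ∧ x ≠ v ∧ w ∈ G.branch x u} := by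
  refine branch_subset_of_closed (Or.inl rfl) fun a b ha hab hs => ?_
  rcases ha with rfl | ⟨x, hx, hne, ha⟩
  · exact Or.inr ⟨b, hab.symm, fun h => hs (by rw [h]), mem_branch_self _ _⟩
  · by_cases h : s(a, b) = s(x, u)
    · rcases Sym2.eq_iff.mp h with ⟨-, rfl⟩ | ⟨-, rfl⟩
      · exact Or.inl rfl
      · exact Or.inr ⟨b, hx, hne, mem_branch_self _ _⟩
    · exact Or.inr ⟨x, hx, hne, mem_branch_of_adj ha hab h⟩

end SimpleGraph

namespace BranchDecomp

variable {α : Type} [Fintype α] (B : BranchDecomp α)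

theorem mem_side_iff (u v : B.τ) (x : α) :
    x ∈ B.side u v ↔ ((B.δ.symm x : {v : B.τ // B.T.degree v = 1}) : B.τ) ∈ B.T.branch u v :=
  Iff.rfl

theorem clusterTree_side {p : Set α → Prop} (hp : ∀ u v, B.T.Adj u v → p (B.side u v)) :
    ∀ (n : ℕ) (u v : B.τ), B.T.Adj u v → (B.T.branch u v).ncard = n →
      ClusterTree p (B.side u v) := by
  have hac := B.isTree.isAcyclic
  intro n
  induction n using Nat.strong_induction_on with
  | _ n ih =>
  intro u v huv hn
  have hlt : ∀ x, B.T.Adj x u → x ≠ v → ClusterTree p (B.side x u) := fun x hx hne =>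
    ih _ (hn ▸ Set.ncard_lt_ncard ((Set.ssubset_iff_of_subset
      (hac.branch_subset_branch hx hne)).mpr
        ⟨u, SimpleGraph.mem_branch_self _ _, hac.notMem_branch hx⟩)) x u hx rfl
  have hcard : (B.T.neighborSet u).ncard = B.T.degree u := by
    rw [← SimpleGraph.card_neighborSet_eq_degree, ← Nat.card_eq_fintype_card,
      Nat.card_coe_set_eq]
  rcases B.deg u with hd | hd
  · rw [hd, Set.ncard_eq_one] at hcard
    obtain ⟨v', hv'⟩ := hcard
    have hnb : ∀ x, B.T.Adj u x → x = v := fun x hx => by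
      have h1 : x ∈ B.T.neighborSet u := hx
      have h2 : v ∈ B.T.neighborSet u := huv
      rw [hv'] at h1 h2
      exact h1.trans h2.symm
    have hs : B.side u v = {B.δ ⟨u, hd⟩} := by
      ext x
      rw [mem_side_iff, Set.mem_singleton_iff, ← Equiv.symm_apply_eq, Subtype.ext_iff]
      constructor
      · intro hx
        rcases SimpleGraph.branch_subset_iUnion u v hx with h | ⟨y, hy, hne, -⟩
        · exact h
        · exact absurd (hnb y hy.symm) hne
      · intro hx
        rw [hx]
        exact SimpleGraph.mem_branch_self _ _
    rw [hs]
    exact .single _ (hs ▸ hp u v huv)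
  · have hv : v ∈ B.T.neighborSet u := huv
    rw [hd] at hcard
    have h2 : (B.T.neighborSet u \ {v}).ncard = 2 := by
      rw [Set.ncard_sdiff_singleton_of_mem hv, hcard]
    obtain ⟨a, b, hab, hset⟩ := Set.ncard_eq_two.mp h2
    have ha : a ∈ B.T.neighborSet u \ {v} := hset ▸ by simp
    have hb : b ∈ B.T.neighborSet u \ {v} := hset ▸ by simp
    have hs : B.side u v = B.side a u ∪ B.side b u := by
      ext x
      rw [Set.mem_union, mem_side_iff, mem_side_iff, mem_side_iff]
      constructor
      · intro hx
        rcases SimpleGraph.branch_subset_iUnion u v hx with h | ⟨y, hy, hne, hxy⟩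
        · have := (B.δ.symm x).2
          rw [Set.mem_singleton_iff.mp h] at this
          omega
        · have : y ∈ B.T.neighborSet u \ {v} := ⟨hy.symm, hne⟩
          rw [hset] at this
          rcases this with rfl | rfl
          · exact Or.inl hxy
          · exact Or.inr hxy
      · rintro (h | h)
        · exact hac.branch_subset_branch ha.1.symm ha.2 h
        · exact hac.branch_subset_branch hb.1.symm hb.2 h
    have hdisj : Disjoint (B.side a u) (B.side b u) := by
      refine Set.disjoint_left.mpr fun x hx hx' => ?_
      exact Set.disjoint_left.mp (hac.disjoint_branch ha.1.symm) hx
        (hac.branch_subset_branch hb.1.symm hab.symm hx')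
    rw [hs]
    exact .union _ _ hdisj (hlt a ha.1.symm ha.2) (hlt b hb.1.symm hb.2) (hs ▸ hp u v huv)

theorem clusterTree_univ {p : Set α → Prop} (hp : ∀ u v, B.T.Adj u v → p (B.side u v))
    (huniv : p Set.univ) [Nonempty α] : ClusterTree p Set.univ := by
  obtain ⟨x⟩ := ‹Nonempty α›
  obtain ⟨v, hv⟩ : ∃ v, B.T.Adj (B.δ.symm x : {v : B.τ // B.T.degree v = 1}) v := by
    rw [← SimpleGraph.degree_pos_iff_exists_adj, (B.δ.symm x).2]
    exact one_pos
  have hU : B.side (B.δ.symm x : {v : B.τ // B.T.degree v = 1}) v ∪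
      B.side v (B.δ.symm x : {v : B.τ // B.T.degree v = 1}) = Set.univ := by
    refine Set.eq_univ_of_forall fun y => ?_
    have := B.isTree.connected.branch_union_branch
      (B.δ.symm x : {v : B.τ // B.T.degree v = 1}) v
    exact Set.eq_univ_iff_forall.mp this (B.δ.symm y : {v : B.τ // B.T.degree v = 1})
  rw [← hU] at huniv ⊢
  refine .union _ _ ?_ (B.clusterTree_side hp _ _ _ hv rfl)
    (B.clusterTree_side hp _ _ _ hv.symm rfl) huniv
  exact Set.disjoint_left.mpr fun y hy hy' =>
    Set.disjoint_left.mp (B.isTree.isAcyclic.disjoint_branch hv) hy hy'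

end BranchDecomp

/-- The graph obtained from the disjoint union of `T₁` and `T₂` by adding the edge `r₁r₂`. -/
def SimpleGraph.joinAt {τ₁ τ₂ : Type} (T₁ : SimpleGraph τ₁) (r₁ : τ₁) (T₂ : SimpleGraph τ₂)
    (r₂ : τ₂) : SimpleGraph (τ₁ ⊕ τ₂) where
  Adj
    | .inl a, .inl b => T₁.Adj a b
    | .inr a, .inr b => T₂.Adj a b
    | .inl a, .inr b => a = r₁ ∧ b = r₂
    | .inr b, .inl a => a = r₁ ∧ b = r₂
  symm := ⟨by
    rintro (a | a) (b | b) h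
    · exact SimpleGraph.Adj.symm h
    · exact h
    · exact h
    · exact SimpleGraph.Adj.symm h⟩
  loopless := ⟨by
    rintro (a | a) h
    · exact T₁.loopless.irrefl a h
    · exact T₂.loopless.irrefl a h⟩

/-- The permitted combinations of degree and label set of a vertex: leaves carry one label and
vertices of degree three carry none. -/
def IsNode {α : Type} (n : ℕ) (L : Set α) : Prop :=
  (n = 1 ∧ ∃ x, L = {x}) ∨ (n = 3 ∧ L = ∅)

/-- A connected graph `T` rooted at `r` with disjoint label sets, each of whose edges is the unique
edge leaving a vertex set that avoids `r` and whose labels satisfy `p`. Every vertex other than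
`r` is a leaf with one label or has degree three and no label. -/
structure IsRootedDecomp {α τ : Type} (p : Set α → Prop) (T : SimpleGraph τ) (r : τ)
    (lab : τ → Set α) : Prop where
  reach : ∀ w, T.Reachable r w
  cut : ∀ u v, T.Adj u v → ∃ C : Set τ, r ∉ C ∧ (u ∈ C ↔ v ∉ C) ∧
    (∀ a b, a ∈ C → b ∉ C → T.Adj a b → s(a, b) = s(u, v)) ∧ p (⋃ w ∈ C, lab w)
  disj : ∀ w w' x, x ∈ lab w → x ∈ lab w' → w = w'
  node : ∀ w, w ≠ r → IsNode (T.neighborSet w).ncard (lab w)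

section Join

variable {τ₁ τ₂ : Type} {T₁ : SimpleGraph τ₁} {r₁ : τ₁} {T₂ : SimpleGraph τ₂} {r₂ : τ₂}

theorem SimpleGraph.ncard_neighborSet_joinAt_inl [Finite τ₁] [Finite τ₂] (w : τ₁) :
    ((T₁.joinAt r₁ T₂ r₂).neighborSet (.inl w)).ncard =
      (T₁.neighborSet w).ncard + if w = r₁ then 1 else 0 := by
  split_ifs with h
  · have : (T₁.joinAt r₁ T₂ r₂).neighborSet (.inl w) =
        insert (.inr r₂) (Sum.inl '' T₁.neighborSet w) := by
      ext (b | b) <;> simp [joinAt, h]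
    rw [this, Set.ncard_insert_of_notMem (by simp) (Set.toFinite _),
      Set.ncard_image_of_injective _ Sum.inl_injective]
  · have : (T₁.joinAt r₁ T₂ r₂).neighborSet (.inl w) = Sum.inl '' T₁.neighborSet w := by
      ext (b | b) <;> simp [joinAt, h]
    rw [this, Set.ncard_image_of_injective _ Sum.inl_injective, add_zero]

theorem SimpleGraph.ncard_neighborSet_joinAt_inr [Finite τ₁] [Finite τ₂] (w : τ₂) :
    ((T₁.joinAt r₁ T₂ r₂).neighborSet (.inr w)).ncard =
      (T₂.neighborSet w).ncard + if w = r₂ then 1 else 0 := by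
  split_ifs with h
  · have : (T₁.joinAt r₁ T₂ r₂).neighborSet (.inr w) =
        insert (.inl r₁) (Sum.inr '' T₂.neighborSet w) := by
      ext (b | b) <;> simp [joinAt, h]
    rw [this, Set.ncard_insert_of_notMem (by simp) (Set.toFinite _),
      Set.ncard_image_of_injective _ Sum.inr_injective]
  · have : (T₁.joinAt r₁ T₂ r₂).neighborSet (.inr w) = Sum.inr '' T₂.neighborSet w := by
      ext (b | b) <;> simp [joinAt, h]
    rw [this, Set.ncard_image_of_injective _ Sum.inr_injective, add_zero]

variable {α : Type} {p : Set α → Prop} {lab₁ : τ₁ → Set α} {lab₂ : τ₂ → Set α}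

theorem IsRootedDecomp.joinAt [Finite τ₁] [Finite τ₂] (h₁ : IsRootedDecomp p T₁ r₁ lab₁)
    (h₂ : IsRootedDecomp p T₂ r₂ lab₂) (hp : p (⋃ w, lab₂ w))
    (hr₂ : IsNode ((T₂.neighborSet r₂).ncard + 1) (lab₂ r₂))
    (hd : Disjoint (⋃ w, lab₁ w) (⋃ w, lab₂ w)) :
    IsRootedDecomp p (T₁.joinAt r₁ T₂ r₂) (.inl r₁) (Sum.elim lab₁ lab₂) where
  reach := by
    have e : (T₁.joinAt r₁ T₂ r₂).Adj (.inl r₁) (.inr r₂) := ⟨rfl, rfl⟩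
    rintro (w | w)
    · exact (h₁.reach w).map (G' := T₁.joinAt r₁ T₂ r₂) ⟨Sum.inl, id⟩
    · exact e.reachable.trans ((h₂.reach w).map (G' := T₁.joinAt r₁ T₂ r₂) ⟨Sum.inr, id⟩)
  cut := by
    have left : ∀ u v, T₁.Adj u v → ∃ C : Set (τ₁ ⊕ τ₂), .inl r₁ ∉ C ∧
        (.inl u ∈ C ↔ .inl v ∉ C) ∧
        (∀ a b, a ∈ C → b ∉ C → (T₁.joinAt r₁ T₂ r₂).Adj a b → s(a, b) = s(.inl u, .inl v)) ∧
        p (⋃ w ∈ C, Sum.elim lab₁ lab₂ w) := by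
      intro u v huv
      obtain ⟨C, hr, huC, hC, hpC⟩ := h₁.cut u v huv
      refine ⟨Sum.inl '' C, by simpa using hr, by simpa using huC, ?_, by simpa using hpC⟩
      rintro _ (b | b) ⟨a, ha, rfl⟩ hb hab
      · have := hC a b ha (by simpa using hb) hab
        simpa using this
      · exact absurd (hab.1 ▸ ha) hr
    have right : ∀ u v, T₂.Adj u v → ∃ C : Set (τ₁ ⊕ τ₂), .inl r₁ ∉ C ∧
        (.inr u ∈ C ↔ .inr v ∉ C) ∧
        (∀ a b, a ∈ C → b ∉ C → (T₁.joinAt r₁ T₂ r₂).Adj a b → s(a, b) = s(.inr u, .inr v)) ∧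
        p (⋃ w ∈ C, Sum.elim lab₁ lab₂ w) := by
      intro u v huv
      obtain ⟨C, hr, huC, hC, hpC⟩ := h₂.cut u v huv
      refine ⟨Sum.inr '' C, by simp, by simpa using huC, ?_, by simpa using hpC⟩
      rintro _ (b | b) ⟨a, ha, rfl⟩ hb hab
      · exact absurd (hab.2 ▸ ha) hr
      · have := hC a b ha (by simpa using hb) hab
        simpa using this
    have mid : ∀ a b, a ∈ Set.range (Sum.inr : τ₂ → τ₁ ⊕ τ₂) →
        b ∉ Set.range (Sum.inr : τ₂ → τ₁ ⊕ τ₂) → (T₁.joinAt r₁ T₂ r₂).Adj a b →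
        s(a, b) = s(.inl r₁, .inr r₂) := by
      rintro _ (b | b) ⟨a, rfl⟩ hb hab
      · rw [hab.1, hab.2, Sym2.eq_swap]
      · exact absurd ⟨b, rfl⟩ hb
    rintro (u | u) (v | v) huv
    · exact left u v huv
    · obtain ⟨rfl, rfl⟩ := huv
      exact ⟨Set.range Sum.inr, by simp, by simp, mid, by simpa using hp⟩
    · obtain ⟨rfl, rfl⟩ := huv
      refine ⟨Set.range Sum.inr, by simp, by simp, ?_, by simpa using hp⟩
      rw [Sym2.eq_swap]
      exact mid
    · exact right u v huv
  disj := by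
    rintro (w | w) (w' | w') x hw hw'
    · rw [h₁.disj w w' x hw hw']
    · exact absurd (Set.mem_iUnion_of_mem w' hw')
        (Set.disjoint_left.mp hd (Set.mem_iUnion_of_mem w hw))
    · exact absurd (Set.mem_iUnion_of_mem w hw)
        (Set.disjoint_left.mp hd (Set.mem_iUnion_of_mem w' hw'))
    · rw [h₂.disj w w' x hw hw']
  node := by
    rintro (w | w) hw
    · have hne : w ≠ r₁ := fun h => hw (by rw [h])
      rw [SimpleGraph.ncard_neighborSet_joinAt_inl, if_neg hne]
      exact h₁.node w hne
    · rw [SimpleGraph.ncard_neighborSet_joinAt_inr]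
      split_ifs with h
      · rw [h]
        exact hr₂
      · exact h₂.node w h

end Join

theorem isRootedDecomp_point {α : Type} (p : Set α → Prop) (L : Set α) :
    IsRootedDecomp p (⊥ : SimpleGraph Unit) () fun _ => L where
  reach _ := .rfl
  cut _ _ h := h.elim
  disj _ _ _ _ _ := rfl
  node _ h := absurd rfl h

theorem ncard_neighborSet_bot (w : Unit) : ((⊥ : SimpleGraph Unit).neighborSet w).ncard = 0 := by
  simp [SimpleGraph.neighborSet]

theorem ClusterTree.exists_isRootedDecomp {α : Type} {p : Set α → Prop} {S : Set α}
    (h : ClusterTree p S) : ∃ (τ : Type) (_ : Fintype τ) (T : SimpleGraph τ) (r : τ)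
      (lab : τ → Set α), IsRootedDecomp p T r lab ∧
        IsNode ((T.neighborSet r).ncard + 1) (lab r) ∧ ⋃ w, lab w = S := by
  induction h with
  | single x _ =>
    refine ⟨Unit, inferInstance, ⊥, (), fun _ => {x}, isRootedDecomp_point p _, ?_, by simp⟩
    exact Or.inl ⟨by rw [ncard_neighborSet_bot], x, rfl⟩
  | union A B hd hA hB hp ihA ihB =>
    obtain ⟨τ₁, _, T₁, r₁, lab₁, h₁, hr₁, rfl⟩ := ihA
    obtain ⟨τ₂, _, T₂, r₂, lab₂, h₂, hr₂, rfl⟩ := ihB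
    have h₀ := (isRootedDecomp_point p ∅).joinAt h₁ hA.self hr₁ (by simp)
    refine ⟨_, inferInstance, _, _, _, h₀.joinAt h₂ hB.self hr₂ ?_, Or.inr ⟨?_, rfl⟩, ?_⟩
    · simpa [Set.iUnion_sum] using hd
    · rw [SimpleGraph.ncard_neighborSet_joinAt_inl, SimpleGraph.ncard_neighborSet_joinAt_inl,
        ncard_neighborSet_bot]
      simp
    · simp [Set.iUnion_sum]

theorem IsRootedDecomp.exists_branchDecomp {α τ : Type} [Fintype α] [Fintype τ]
    {p : Set α → Prop} (hsymm : ∀ A, p A → p Aᶜ) {T : SimpleGraph τ} {r : τ} {lab : τ → Set α}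
    (h : IsRootedDecomp p T r lab) (hr : IsNode (T.neighborSet r).ncard (lab r))
    (huniv : ⋃ w, lab w = Set.univ) :
    ∃ B : BranchDecomp α, ∀ u v, B.T.Adj u v → p (B.side u v) := by
  have hnode : ∀ w, IsNode (T.degree w) (lab w) := by
    intro w
    have hcard : (T.neighborSet w).ncard = T.degree w := by
      rw [← SimpleGraph.card_neighborSet_eq_degree, ← Nat.card_eq_fintype_card,
        Nat.card_coe_set_eq]
    rw [← hcard]
    by_cases hw : w = r
    · rwa [hw]
    · exact h.node w hw
  have hconn : T.Connected :=
    { preconnected := fun a b => (h.reach a).symm.trans (h.reach b), nonempty := ⟨r⟩ }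
  have hbr : ∀ (u v : τ) (C : Set τ), (∀ a b, a ∈ C → b ∉ C → T.Adj a b → s(a, b) = s(u, v)) →
      u ∈ C → T.branch u v ⊆ C := by
    intro u v C hC hu
    refine SimpleGraph.branch_subset_of_closed hu fun a b ha hab hne => ?_
    by_contra hb
    exact hne (hC a b ha hb hab)
  have hcut : ∀ u v, T.Adj u v → v ∉ T.branch u v ∧ p (⋃ w ∈ T.branch u v, lab w) := by
    have aux : ∀ u v (C : Set τ), u ∈ C → v ∉ C →
        (∀ a b, a ∈ C → b ∉ C → T.Adj a b → s(a, b) = s(u, v)) → T.branch u v = C := by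
      intro u v C hu hv hC
      refine (hbr u v C hC hu).antisymm fun w hw => ?_
      rcases Set.eq_univ_iff_forall.mp (hconn.branch_union_branch u v) w with h | h
      · exact h
      · refine absurd hw (hbr v u Cᶜ (fun a b ha hb hab => ?_) hv h)
        rw [Sym2.eq_swap, Sym2.eq_swap (a := v)]
        exact hC b a (not_not.mp hb) ha hab.symm
    intro u v huv
    obtain ⟨C, -, huC, hC, hpC⟩ := h.cut u v huv
    by_cases hu : u ∈ C
    · rw [aux u v C hu (huC.mp hu) hC]
      exact ⟨huC.mp hu, hpC⟩
    · have hv : v ∈ C := by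
        by_contra hv
        exact hu (huC.mpr hv)
      rw [aux u v Cᶜ hu (not_not.mpr hv) fun a b ha hb hab => by
        rw [Sym2.eq_swap]
        exact hC b a (not_not.mp hb) ha hab.symm]
      refine ⟨not_not.mpr hv, ?_⟩
      have hcompl : ⋃ w ∈ Cᶜ, lab w = (⋃ w ∈ C, lab w)ᶜ := by
        ext x
        obtain ⟨w, hw⟩ := Set.mem_iUnion.mp (Set.eq_univ_iff_forall.mp huniv x)
        simp only [Set.mem_iUnion, Set.mem_compl_iff, exists_prop, not_exists, not_and]
        constructor
        · rintro ⟨w', hw', hx⟩ w'' hw'' hx'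
          exact hw' (h.disj _ _ _ hx hx' ▸ hw'')
        · exact fun H => ⟨w, fun hwC => H w hwC hw, hw⟩
      rw [hcompl]
      exact hsymm _ hpC
  have hleaf : ∀ w : {w : τ // T.degree w = 1}, ∃ x, lab w = {x} := by
    rintro ⟨w, hw⟩
    rcases hnode w with ⟨-, hx⟩ | ⟨h3, -⟩
    · exact hx
    · omega
  choose g hg using hleaf
  have hbij : Function.Bijective g := by
    constructor
    · intro a b hab
      refine Subtype.ext (h.disj _ _ (g a) (by simp [hg]) ?_)
      rw [hab]
      simp [hg]
    · intro x
      obtain ⟨w, hw⟩ := Set.mem_iUnion.mp (Set.eq_univ_iff_forall.mp huniv x)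
      rcases hnode w with ⟨h1, -⟩ | ⟨-, h0⟩
      · refine ⟨⟨w, h1⟩, ?_⟩
        rw [hg ⟨w, h1⟩] at hw
        exact hw.symm
      · rw [h0] at hw
        exact hw.elim
  refine ⟨⟨τ, T, ⟨hconn, ?_⟩, fun w => (hnode w).imp And.left And.left,
    Equiv.ofBijective g hbij⟩, fun u v huv => ?_⟩
  · exact SimpleGraph.isAcyclic_iff_forall_adj_isBridge.mpr fun u v huv => (hcut u v huv).1
  · convert (hcut u v huv).2
    ext x
    obtain ⟨w, rfl⟩ := hbij.2 x
    rw [BranchDecomp.mem_side_iff]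
    simp only [Set.mem_iUnion, exists_prop]
    have hsy : (Equiv.ofBijective g hbij).symm (g w) = w :=
      Equiv.ofBijective_symm_apply_apply g hbij w
    rw [hsy]
    constructor
    · exact fun hw => ⟨w, hw, by simp [hg]⟩
    · rintro ⟨w', hw', hx⟩
      exact h.disj w' w (g w) hx (by simp [hg]) ▸ hw'

theorem ClusterTree.exists_branchDecomp {α : Type} [Fintype α] {p : Set α → Prop}
    (hsymm : ∀ A, p A → p Aᶜ) (hcard : 1 < Fintype.card α) (h : ClusterTree p Set.univ) :
    ∃ B : BranchDecomp α, ∀ u v, B.T.Adj u v → p (B.side u v) := by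
  generalize hS : (Set.univ : Set α) = S at h
  cases h with
  | single x _ =>
    have : Fintype.card α ≤ 1 := Fintype.card_le_one_iff.mpr fun a b => by
      rw [Set.eq_singleton_iff_unique_mem] at hS
      rw [hS.2 a trivial, hS.2 b trivial]
    omega
  | union A B hd hA hB hp =>
    obtain ⟨τ₁, _, T₁, r₁, lab₁, h₁, hr₁, rfl⟩ := hA.exists_isRootedDecomp
    obtain ⟨τ₂, _, T₂, r₂, lab₂, h₂, hr₂, rfl⟩ := hB.exists_isRootedDecomp
    refine (h₁.joinAt h₂ hB.self hr₂ hd).exists_branchDecomp hsymm ?_ ?_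
    · rw [SimpleGraph.ncard_neighborSet_joinAt_inl, if_pos rfl]
      exact hr₁
    · rw [Set.iUnion_sum, hS]
      rfl

theorem BranchDecomp.width_le {α : Type} [Fintype α] (B : BranchDecomp α) {f : Set α → ℕ} {k : ℕ}
    (h : ∀ u v, B.T.Adj u v → f (B.side u v) ≤ k) : B.width f ≤ k := by
  refine csSup_le' ?_
  rintro _ ⟨u, v, huv, rfl⟩
  exact h u v huv

theorem BranchDecomp.le_width {α : Type} [Fintype α] (B : BranchDecomp α) (f : Set α → ℕ)
    {u v : B.τ} (h : B.T.Adj u v) : f (B.side u v) ≤ B.width f := by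
  refine le_csSup (Set.Finite.bddAbove ?_) ⟨u, v, h, rfl⟩
  refine (Set.finite_range fun q : B.τ × B.τ => f (B.side q.1 q.2)).subset ?_
  rintro _ ⟨u, v, -, rfl⟩
  exact ⟨(u, v), rfl⟩

theorem exists_width_eq_fWidth {α : Type} [Fintype α] (hcard : 1 < Fintype.card α)
    (f : Set α → ℕ) : ∃ B : BranchDecomp α, B.width f = fWidth α f := by
  have : Nonempty α := Fintype.card_pos_iff.mp (by omega)
  rw [fWidth, if_neg (by omega)]
  obtain ⟨B, -⟩ := (ClusterTree.of_forall_subset (p := fun _ : Set α => True) Set.finite_univ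
    Set.univ_nonempty fun _ _ => trivial).exists_branchDecomp (fun _ _ => trivial) hcard
  exact Nat.sInf_mem (s := {n | ∃ B : BranchDecomp α, B.width f = n}) ⟨_, B, rfl⟩

theorem qRankWidth_le_of_clusterTree {V : Type} [Fintype V] {G : SimpleGraph V} {k : ℕ}
    (h : Nonempty V → ClusterTree (fun A => ∃ C, CoversCut G A C ∧ C.ncard ≤ k) Set.univ) :
    qRankWidth G ≤ k := by
  rw [qRankWidth, fWidth]
  split_ifs with hcard
  · refine (cutRank_le_of_coversCut ℚ (C := ∅) fun a ha => ha.elim).trans ?_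
    simp
  · have hcard' : 1 < Fintype.card V := by omega
    have hne : Nonempty V := Fintype.card_pos_iff.mp (by omega)
    obtain ⟨B, hB⟩ := (h hne).exists_branchDecomp
      (fun _ h => h.imp fun _ hC => ⟨hC.1.compl, hC.2⟩) hcard'
    refine (Nat.sInf_le (s := {n | ∃ B : BranchDecomp V, B.width (cutRank ℚ G) = n})
      ⟨B, rfl⟩).trans (B.width_le fun u v huv => ?_)
    obtain ⟨C, hC, hk⟩ := hB u v huv
    exact (cutRank_le_of_coversCut ℚ hC).trans hk

section Edges

variable {V : Type} {G : SimpleGraph V} {φ : V → ↥G.edgeSet}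

/-- If every non-isolated vertex is sent to an incident edge, then the boundary of an edge set
meets all edges leaving its preimage. -/
theorem coversCut_preimage (hφ : ∀ v w, G.Adj v w → v ∈ (φ v).1) (X : Set ↥G.edgeSet) :
    CoversCut G (φ ⁻¹' X)
      (incVerts (Subtype.val '' X) ∩ incVerts (G.edgeSet \ Subtype.val '' X)) := by
  intro a ha b hb hab
  by_cases hX : s(a, b) ∈ Subtype.val '' X
  · refine Or.inr ⟨⟨_, hX, Sym2.mem_mk_right a b⟩, (φ b).1, ⟨(φ b).2, ?_⟩, hφ b a hab.symm⟩
    rintro ⟨e, he, heq⟩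
    exact hb (by rwa [Set.mem_preimage, ← Subtype.ext heq])
  · exact Or.inl ⟨⟨_, ⟨φ a, ha, rfl⟩, hφ a b hab⟩, s(a, b), ⟨hab, hX⟩, Sym2.mem_mk_left a b⟩

/-- Any part of a fibre is covered by at most one vertex or by the boundary of the edge. -/
theorem exists_coversCut_of_subset_fiber (hφ : ∀ v w, G.Adj v w → v ∈ (φ v).1)
    (e : ↥G.edgeSet) {A : Set V} (hA : A ⊆ φ ⁻¹' {e}) :
    (∃ v, CoversCut G A {v}) ∨ CoversCut G A
      (incVerts (Subtype.val '' {e}) ∩ incVerts (G.edgeSet \ Subtype.val '' {e})) := by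
  have hmem : ∀ a ∈ A, ∀ b, G.Adj a b → a ∈ e.1 := fun a ha b hab => by
    have := hφ a b hab
    rwa [show φ a = e from hA ha] at this
  obtain ⟨⟨u, v⟩, he⟩ := e
  by_cases hu : u ∈ A
  · by_cases hv : v ∈ A
    · right
      intro a ha b hb hab
      have hae := hmem a ha b hab
      refine Or.inl ⟨⟨_, ⟨_, rfl, rfl⟩, hae⟩, s(a, b), ⟨hab, ?_⟩, Sym2.mem_mk_left a b⟩
      rintro ⟨_, rfl, heq⟩
      have hbe : b ∈ s(u, v) := by
        change s(u, v) = s(a, b) at heq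
        rw [heq]
        exact Sym2.mem_mk_right a b
      rcases Sym2.mem_iff.mp hbe with rfl | rfl
      · exact hb hu
      · exact hb hv
    · refine Or.inl ⟨u, fun a ha b hb hab => Or.inl ?_⟩
      rcases Sym2.mem_iff.mp (hmem a ha b hab) with rfl | rfl
      · rfl
      · exact absurd ha hv
  · refine Or.inl ⟨v, fun a ha b hb hab => Or.inl ?_⟩
    rcases Sym2.mem_iff.mp (hmem a ha b hab) with rfl | rfl
    · exact absurd ha hu
    · rfl

end Edges

theorem SimpleGraph.exists_incident_edge_map {V : Type} (G : SimpleGraph V) [Nonempty G.edgeSet] :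
    ∃ φ : V → ↥G.edgeSet, ∀ v w, G.Adj v w → v ∈ (φ v).1 := by
  have : ∀ v, ∃ e : ↥G.edgeSet, ∀ w, G.Adj v w → v ∈ e.1 := by
    intro v
    by_cases h : ∃ w, G.Adj v w
    · obtain ⟨w, hw⟩ := h
      exact ⟨⟨s(v, w), hw⟩, fun _ _ => Sym2.mem_mk_left v w⟩
    · exact ⟨Classical.arbitrary _, fun w hw => absurd ⟨w, hw⟩ h⟩
  choose φ hφ using this
  exact ⟨φ, hφ⟩

theorem exists_coversCut_of_subsingleton {V : Type} (G : SimpleGraph V)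
    [Subsingleton G.edgeSet] (A : Set V) : ∃ C, CoversCut G A C ∧ C.ncard ≤ 1 := by
  by_cases h : ∃ a ∈ A, ∃ b ∉ A, G.Adj a b
  · obtain ⟨a, ha, b, hb, hab⟩ := h
    refine ⟨{a}, fun a' ha' b' hb' hab' => Or.inl ?_, (Set.ncard_singleton a).le⟩
    have heq : s(a', b') = s(a, b) := congrArg Subtype.val
      (Subsingleton.elim (⟨s(a', b'), hab'⟩ : G.edgeSet) ⟨s(a, b), hab⟩)
    rcases Sym2.eq_iff.mp heq with ⟨rfl, -⟩ | ⟨rfl, -⟩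
    · rfl
    · exact absurd ha' hb
  · push Not at h
    exact ⟨∅, fun a ha b hb hab => absurd hab (h a ha b hb), by simp⟩

theorem stmt6 {V : Type} [Fintype V] (G : SimpleGraph V) :
    qRankWidth G ≤ max (graphBranchWidth G) 1 := by
  refine qRankWidth_le_of_clusterTree fun hV => ?_
  by_cases hcard : Fintype.card ↥G.edgeSet ≤ 1
  · have := Fintype.card_le_one_iff_subsingleton.mp hcard
    refine .of_forall_subset Set.finite_univ Set.univ_nonempty fun A _ => ?_
    obtain ⟨C, hC, h1⟩ := exists_coversCut_of_subsingleton G A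
    exact ⟨C, hC, h1.trans (le_max_right _ _)⟩
  · have hne : Nonempty ↥G.edgeSet := Fintype.card_pos_iff.mp (by omega)
    obtain ⟨B, hB⟩ := exists_width_eq_fWidth (not_le.mp hcard) (etaE G)
    obtain ⟨φ, hφ⟩ := G.exists_incident_edge_map
    have hB' : ClusterTree (fun X => etaE G X ≤ graphBranchWidth G) Set.univ := by
      refine B.clusterTree_univ (fun u v huv => (B.le_width _ huv).trans_eq hB) ?_
      simp [etaE, eta, incVerts]
    refine hB'.preimage φ ?_ ?_ Set.univ_nonempty
    · intro e he A hA
      rcases exists_coversCut_of_subset_fiber hφ e hA with ⟨v, hv⟩ | h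
      · exact ⟨{v}, hv, (Set.ncard_singleton v).le.trans (le_max_right _ _)⟩
      · exact ⟨_, h, he.trans (le_max_left _ _)⟩
    · exact fun X hX => ⟨_, coversCut_preimage hφ X, hX.trans (le_max_left _ _)⟩
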